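/- Let γ > 1, let w_1, …, w_s be unit vectors in ℝⁿ and c_1, …, c_s > 0 satisfy I_n ⪯ Σ_{j=1}^s c_j w_j ⊗ w_j ⪯ γ I_n. Then the volume of the intersection of strips ⋂_{j=1}^s {x ∈ ℝⁿ : |⟨x, w_j⟩| ≤ 1} is at most 2ⁿ γ^{n/2}. -/

import Mathlib

open MeasureTheory
open scoped Matrix

open Filter Topology Set in
/-- The increasing transport of the uniform density on `(-1, 1)` to the Gaussian density
`exp (-π t²)`. -/
theorem exists_gaussian_transport :
    ∃ T : ℝ → ℝ, StrictMonoOn T (Ioo (-1) 1) ∧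
      ∀ a ∈ Ioo (-1 : ℝ) 1, HasDerivAt T (Real.exp (Real.pi * T a ^ 2) / 2) a := by
  let g : ℝ → ℝ := fun t ↦ Real.exp (-Real.pi * t ^ 2)
  have hg : Continuous g := by fun_prop
  let F : ℝ → ℝ := fun t ↦ 2 * ∫ x in (0 : ℝ)..t, g x
  have hF : ∀ t, HasDerivAt F (2 * g t) t := fun t ↦
    (intervalIntegral.integral_hasDerivAt_right (hg.intervalIntegrable _ _)
      hg.stronglyMeasurable.stronglyMeasurableAtFilter hg.continuousAt).const_mul 2
  have hFc : Continuous F := continuous_iff_continuousAt.2 fun t ↦ (hF t).continuousAt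
  have hmono : StrictMono F := strictMono_of_hasDerivAt_pos hF fun t ↦ by positivity
  have htop : Tendsto F atTop (𝓝 1) := by
    have h := (intervalIntegral_tendsto_integral_Ioi 0
      (integrable_exp_neg_mul_sq Real.pi_pos).integrableOn tendsto_id).const_mul 2
    rw [integral_gaussian_Ioi, div_self Real.pi_ne_zero, Real.sqrt_one,
      mul_one_div_cancel two_ne_zero] at h
    exact h
  have hodd : ∀ t, F (-t) = -F t := by
    intro t
    have h := intervalIntegral.integral_comp_neg (a := 0) (b := t) g
    have h' : ∀ x, g (-x) = g x := fun x ↦ by simp [g]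
    simp only [h', neg_zero] at h
    simp only [F]
    rw [h, intervalIntegral.integral_symm (-t) 0]
    ring
  have hlt : ∀ t, F t < 1 := fun t ↦
    (hmono (lt_add_one t)).trans_le (hmono.monotone.ge_of_tendsto htop _)
  have hsurj : ∀ a ∈ Ioo (-1 : ℝ) 1, ∃ t, F t = a := by
    intro a ha
    obtain ⟨b, hb⟩ := (htop.eventually (lt_mem_nhds ha.2)).exists
    obtain ⟨d, hd⟩ := (htop.eventually (lt_mem_nhds (neg_lt.1 ha.1))).exists
    exact mem_range_of_exists_le_of_exists_ge hFc ⟨-d, by rw [hodd]; linarith⟩ ⟨b, hb.le⟩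
  have hrange : ∀ t, F t ∈ Ioo (-1 : ℝ) 1 := fun t ↦
    ⟨by have := hlt (-t); rw [hodd] at this; linarith, hlt t⟩
  let T := Function.invFun F
  have hFT : ∀ a ∈ Ioo (-1 : ℝ) 1, F (T a) = a := fun a ha ↦ Function.invFun_eq (hsurj a ha)
  have hTF : ∀ t, T (F t) = t := Function.leftInverse_invFun hmono.injective
  have hT : StrictMonoOn T (Ioo (-1) 1) := fun a ha b hb hab ↦ by
    rwa [← hmono.lt_iff_lt, hFT a ha, hFT b hb]
  refine ⟨T, hT, fun a ha ↦ ?_⟩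
  have himg : T '' Ioo (-1) 1 = univ := eq_univ_of_forall fun t ↦ ⟨F t, hrange t, hTF t⟩
  have hnhds : Ioo (-1 : ℝ) 1 ∈ 𝓝 a := isOpen_Ioo.mem_nhds ha
  have h := (hF (T a)).of_local_left_inverse
    (hT.continuousAt_of_image_mem_nhds hnhds (by simp [himg]))
    (by positivity) (by filter_upwards [hnhds] with b hb using hFT b hb)
  refine h.congr_deriv ?_
  rw [mul_inv, ← Real.exp_neg]
  ring_nf

theorem isHermitian_sum_smul_vecMulVec {n ι : Type*} [Fintype ι]
    (a : ι → ℝ) (v : ι → n → ℝ) :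
    (∑ j, a j • Matrix.vecMulVec (v j) (v j)).IsHermitian := by
  ext i k
  simp [Matrix.sum_apply, Matrix.vecMulVec_apply, mul_comm]

section Matrix

variable {n ι : Type*} [Fintype n] [Fintype ι]

theorem sum_smul_vecMulVec_mulVec (a : ι → ℝ) (v : ι → n → ℝ) (x : n → ℝ) :
    (∑ j, a j • Matrix.vecMulVec (v j) (v j)) *ᵥ x = ∑ j, (a j * (x ⬝ᵥ v j)) • v j := by
  rw [Matrix.sum_mulVec]
  refine Finset.sum_congr rfl fun j _ ↦ ?_
  rw [Matrix.smul_mulVec, Matrix.vecMulVec_mulVec, dotProduct_comm x]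
  ext i
  simp
  ring

theorem dotProduct_sum_smul_vecMulVec_mulVec (a : ι → ℝ) (v : ι → n → ℝ) (x : n → ℝ) :
    x ⬝ᵥ (∑ j, a j • Matrix.vecMulVec (v j) (v j)) *ᵥ x = ∑ j, a j * (x ⬝ᵥ v j) ^ 2 := by
  rw [sum_smul_vecMulVec_mulVec, dotProduct_sum]
  refine Finset.sum_congr rfl fun j _ ↦ ?_
  rw [dotProduct_smul, smul_eq_mul]
  ring

theorem sum_mul_sq_dotProduct [DecidableEq n] {c : ι → ℝ} {v : ι → n → ℝ}
    (h : ∑ j, c j • Matrix.vecMulVec (v j) (v j) = 1) (x : n → ℝ) :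
    ∑ j, c j * (x ⬝ᵥ v j) ^ 2 = x ⬝ᵥ x := by
  rw [← dotProduct_sum_smul_vecMulVec_mulVec, h, Matrix.one_mulVec]

theorem sum_mul_dotProduct_self [DecidableEq n] {c : ι → ℝ} {v : ι → n → ℝ}
    (h : ∑ j, c j • Matrix.vecMulVec (v j) (v j) = 1) :
    ∑ j, c j * (v j ⬝ᵥ v j) = Fintype.card n := by
  simpa [Matrix.trace_sum, Matrix.trace_vecMulVec] using congrArg Matrix.trace h

/-- The determinant form of the geometric Brascamp–Lieb inequality. -/
theorem prod_rpow_le_det [DecidableEq n] {c t : ι → ℝ} {v : ι → n → ℝ}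
    (hc : ∀ j, 0 < c j) (ht : ∀ j, 0 < t j)
    (h : ∑ j, c j • Matrix.vecMulVec (v j) (v j) = 1) :
    ∏ j, t j ^ (c j * (v j ⬝ᵥ v j)) ≤
      (∑ j, (c j * t j) • Matrix.vecMulVec (v j) (v j)).det := by
  have hM := isHermitian_sum_smul_vecMulVec (fun j ↦ c j * t j) v
  let e : n → n → ℝ := fun i ↦ ⇑(hM.eigenvectorBasis i)
  have heig : ∀ i, hM.eigenvalues i = ∑ j, c j * (e i ⬝ᵥ v j) ^ 2 * t j := by
    intro i
    rw [hM.eigenvalues_eq, star_trivial, RCLike.re_to_real, dotProduct_sum_smul_vecMulVec_mulVec]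
    exact Finset.sum_congr rfl fun j _ ↦ by simp only [e]; ring
  have hnorm : ∀ i, e i ⬝ᵥ e i = 1 := by
    intro i
    have := hM.eigenvectorBasis.orthonormal.1 i
    rw [EuclideanSpace.norm_eq, Real.sqrt_eq_one] at this
    simpa [dotProduct, e, ← sq] using this
  have hsum : ∀ j, v j ⬝ᵥ v j = ∑ i, (e i ⬝ᵥ v j) ^ 2 := by
    intro j
    have := hM.eigenvectorBasis.sum_sq_inner_right (WithLp.toLp 2 (v j))
    rw [EuclideanSpace.norm_sq_eq] at this
    simp only [EuclideanSpace.inner_eq_star_dotProduct, star_trivial, Real.norm_eq_abs, sq_abs]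
      at this
    simp only [e, dotProduct_comm _ (v j), this]
    simp [dotProduct, sq]
  rw [hM.det_eq_prod_eigenvalues]
  simp only [RCLike.ofReal_real_eq_id, id, heig]
  calc ∏ j, t j ^ (c j * (v j ⬝ᵥ v j))
      = ∏ i, ∏ j, t j ^ (c j * (e i ⬝ᵥ v j) ^ 2) := by
        rw [Finset.prod_comm]
        refine Finset.prod_congr rfl fun j _ ↦ ?_
        rw [hsum, Finset.mul_sum, Real.rpow_sum_of_pos (ht j)]
    _ ≤ _ := by
        refine Finset.prod_le_prod (fun i _ ↦ Finset.prod_nonneg fun j _ ↦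
          (Real.rpow_nonneg (ht j).le _)) fun i _ ↦ ?_
        exact Real.geom_mean_le_arith_mean_weighted _ _ _
          (fun j _ ↦ mul_nonneg (hc j).le (sq_nonneg _))
          (by rw [sum_mul_sq_dotProduct h, hnorm]) fun j _ ↦ (ht j).le

/-- A synthesis operator of a decomposition of the identity is a contraction. -/
theorem dotProduct_self_sum_le [DecidableEq n] {c p : ι → ℝ} {v : ι → n → ℝ}
    (hc : ∀ j, 0 < c j) (h : ∑ j, c j • Matrix.vecMulVec (v j) (v j) = 1) :
    (∑ j, (c j * p j) • v j) ⬝ᵥ (∑ j, (c j * p j) • v j) ≤ ∑ j, c j * p j ^ 2 := by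
  set y := ∑ j, (c j * p j) • v j with hy
  have h1 : y ⬝ᵥ y = ∑ j, c j * p j * (y ⬝ᵥ v j) := by
    conv_lhs => rw [hy, dotProduct_sum, ← hy]
    simp
  have h2 := sum_mul_sq_dotProduct h y
  have h3 : 0 ≤ ∑ j, c j * (p j - y ⬝ᵥ v j) ^ 2 :=
    Finset.sum_nonneg fun j _ ↦ mul_nonneg (hc j).le (sq_nonneg _)
  have h4 : ∑ j, c j * (p j - y ⬝ᵥ v j) ^ 2 =
      ∑ j, c j * p j ^ 2 - 2 * ∑ j, c j * p j * (y ⬝ᵥ v j) + ∑ j, c j * (y ⬝ᵥ v j) ^ 2 := by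
    rw [Finset.mul_sum, ← Finset.sum_sub_distrib, ← Finset.sum_add_distrib]
    exact Finset.sum_congr rfl fun j _ ↦ by ring
  linarith

theorem one_le_det_of_dotProduct_le [DecidableEq n] {A : Matrix n n ℝ} (hA : A.IsHermitian)
    (h : ∀ x, x ⬝ᵥ x ≤ x ⬝ᵥ A *ᵥ x) : 1 ≤ A.det := by
  rw [hA.det_eq_prod_eigenvalues]
  refine Finset.one_le_prod fun i _ ↦ ?_
  have hnorm := hA.eigenvectorBasis.orthonormal.1 i
  rw [EuclideanSpace.norm_eq, Real.sqrt_eq_one] at hnorm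
  have := h (hA.eigenvectorBasis i)
  rw [RCLike.ofReal_real_eq_id, id, hA.eigenvalues_eq, star_trivial, RCLike.re_to_real]
  simpa [dotProduct, ← sq, ← hnorm] using this

theorem lintegral_exp_neg_pi_dotProduct_self :
    ∫⁻ y : n → ℝ, ENNReal.ofReal (Real.exp (-Real.pi * (y ⬝ᵥ y))) = 1 := by
  have h : ∀ y : n → ℝ,
      Real.exp (-Real.pi * (y ⬝ᵥ y)) = ∏ i, Real.exp (-Real.pi * y i ^ 2) := fun y ↦ by
    rw [← Real.exp_sum, ← Finset.mul_sum]
    simp [dotProduct, sq]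
  simp only [h]
  rw [← ofReal_integral_eq_lintegral_ofReal]
  · rw [integral_fintype_prod_volume_eq_prod (fun _ t ↦ Real.exp (-Real.pi * t ^ 2))]
    rw [integral_gaussian, div_self Real.pi_ne_zero]
    simp
  · exact Integrable.fintype_prod (f := fun _ t ↦ Real.exp (-Real.pi * t ^ 2))
      fun _ ↦ integrable_exp_neg_mul_sq Real.pi_pos
  · exact .of_forall fun y ↦ by positivity

end Matrix

theorem measurableSet_setOf_abs_dotProduct_lt_one {n ι : Type*} [Fintype n] [Finite ι]
    (v : ι → n → ℝ) :
    MeasurableSet {x : n → ℝ | ∀ j, |x ⬝ᵥ v j| < 1} := by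
  refine IsOpen.measurableSet ?_
  simp only [Set.ofPred_forall]
  refine isOpen_iInter_of_finite fun j ↦ isOpen_lt ?_ continuous_const
  exact (continuous_id.dotProduct continuous_const).abs

section Strips

variable {n ι : Type*} [Fintype n] [DecidableEq n] [Fintype ι]

/-- Ball's volume bound for an intersection of open strips, by Barthe's transport argument. -/
theorem volume_open_strips_le {c : ι → ℝ} {v : ι → n → ℝ} (hc : ∀ j, 0 < c j)
    (hv : ∀ j, 0 < v j ⬝ᵥ v j) (h : ∑ j, c j • Matrix.vecMulVec (v j) (v j) = 1) :
    volume {x : n → ℝ | ∀ j, |x ⬝ᵥ v j| < 1} ≤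
      ENNReal.ofReal (∏ j, (2 / √(v j ⬝ᵥ v j)) ^ (c j * (v j ⬝ᵥ v j))) := by
  set K := {x : n → ℝ | ∀ j, |x ⬝ᵥ v j| < 1}
  set C := ∏ j, (2 / √(v j ⬝ᵥ v j)) ^ (c j * (v j ⬝ᵥ v j)) with hC
  obtain ⟨T, hTmono, hT⟩ := exists_gaussian_transport
  have hmem : ∀ x ∈ K, ∀ j, x ⬝ᵥ v j ∈ Set.Ioo (-1 : ℝ) 1 := fun x hx j ↦ abs_lt.1 (hx j)
  have hr : ∀ j, 0 < √(v j ⬝ᵥ v j) := fun j ↦ Real.sqrt_pos.2 (hv j)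
  let Θ : (n → ℝ) → n → ℝ := fun x ↦ ∑ j, (c j * (√(v j ⬝ᵥ v j) * T (x ⬝ᵥ v j))) • v j
  let t : (n → ℝ) → ι → ℝ := fun x j ↦
    √(v j ⬝ᵥ v j) * (Real.exp (Real.pi * T (x ⬝ᵥ v j) ^ 2) / 2)
  let M : (n → ℝ) → Matrix n n ℝ := fun x ↦
    ∑ j, (c j * t x j) • Matrix.vecMulVec (v j) (v j)
  have hΘ : ∀ x ∈ K, HasFDerivWithinAt Θ (LinearMap.toContinuousLinearMap (M x).toLin') K x := by
    intro x hx
    let ℓ : ι → (n → ℝ) →L[ℝ] ℝ := fun j ↦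
      LinearMap.toContinuousLinearMap ((dotProductBilin ℝ ℝ).flip (v j))
    have hd : ∀ j, HasFDerivAt (fun x : n → ℝ ↦ (c j * (√(v j ⬝ᵥ v j) * T (x ⬝ᵥ v j))) • v j)
        ((c j • √(v j ⬝ᵥ v j) • (Real.exp (Real.pi * T (x ⬝ᵥ v j) ^ 2) / 2) • ℓ j).smulRight (v j))
        x := fun j ↦
      ((((hT _ (hmem x hx j)).comp_hasFDerivAt x
        (ℓ j).hasFDerivAt).const_mul _).const_mul _).smul_const _
    refine ((HasFDerivAt.fun_sum fun j _ ↦ hd j).congr_fderiv ?_).hasFDerivWithinAt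
    refine ContinuousLinearMap.ext fun y ↦ ?_
    simp only [LinearMap.coe_toContinuousLinearMap', Matrix.toLin'_apply, M,
      sum_smul_vecMulVec_mulVec, _root_.sum_apply]
    refine Finset.sum_congr rfl fun j _ ↦ ?_
    simp [ℓ, t, mul_assoc]
  have hinj : Set.InjOn Θ K := by
    intro x hx y hy hxy
    have hterm : ∀ j, 0 ≤ c j * √(v j ⬝ᵥ v j) *
        ((T (x ⬝ᵥ v j) - T (y ⬝ᵥ v j)) * (x ⬝ᵥ v j - y ⬝ᵥ v j)) := by
      intro j
      refine mul_nonneg (mul_pos (hc j) (hr j)).le ?_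
      rcases le_total (x ⬝ᵥ v j) (y ⬝ᵥ v j) with hle | hle
      · exact mul_nonneg_of_nonpos_of_nonpos
          (sub_nonpos.2 (hTmono.monotoneOn (hmem x hx j) (hmem y hy j) hle)) (sub_nonpos.2 hle)
      · exact mul_nonneg
          (sub_nonneg.2 (hTmono.monotoneOn (hmem y hy j) (hmem x hx j) hle)) (sub_nonneg.2 hle)
    have hzero : ∑ j, c j * √(v j ⬝ᵥ v j) *
        ((T (x ⬝ᵥ v j) - T (y ⬝ᵥ v j)) * (x ⬝ᵥ v j - y ⬝ᵥ v j)) = 0 := by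
      have h0 : (x - y) ⬝ᵥ (Θ x - Θ y) = 0 := by rw [hxy, sub_self, dotProduct_zero]
      rw [← h0, ← Finset.sum_sub_distrib, dotProduct_sum]
      refine Finset.sum_congr rfl fun j _ ↦ ?_
      rw [← sub_smul, dotProduct_smul, sub_dotProduct, smul_eq_mul]
      ring
    have heq : ∀ j, x ⬝ᵥ v j = y ⬝ᵥ v j := by
      intro j
      have := (Finset.sum_eq_zero_iff_of_nonneg fun j _ ↦ hterm j).1 hzero j (Finset.mem_univ j)
      rcases mul_eq_zero.1 this with h1 | h1
      · exact absurd h1 (mul_pos (hc j) (hr j)).ne'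
      · rcases mul_eq_zero.1 h1 with h2 | h2
        · exact hTmono.injOn (hmem x hx j) (hmem y hy j) (sub_eq_zero.1 h2)
        · exact sub_eq_zero.1 h2
    have := sum_mul_sq_dotProduct h (x - y)
    simp only [sub_dotProduct _ _ (v _), heq, sub_self] at this
    rw [← sub_eq_zero, ← dotProduct_self_eq_zero (v := x - y), ← this]
    simp
  have ht : ∀ x j, 0 < t x j := fun x j ↦ mul_pos (hr j) (by positivity)
  have hdet : ∀ x, ∏ j, t x j ^ (c j * (v j ⬝ᵥ v j)) ≤ (M x).det := fun x ↦
    prod_rpow_le_det hc (ht x) h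
  have hC0 : 0 ≤ C := Finset.prod_nonneg fun j _ ↦ Real.rpow_nonneg (by positivity) _
  have hone : ∀ x, 1 ≤ C * (|(M x).det| * Real.exp (-Real.pi * (Θ x ⬝ᵥ Θ x))) := by
    intro x
    have hnorm : Θ x ⬝ᵥ Θ x ≤ ∑ j, c j * (v j ⬝ᵥ v j) * T (x ⬝ᵥ v j) ^ 2 := by
      refine (dotProduct_self_sum_le hc h).trans_eq (Finset.sum_congr rfl fun j _ ↦ ?_)
      rw [mul_pow, Real.sq_sqrt (hv j).le, mul_assoc]
    calc (1 : ℝ) = C * ((∏ j, t x j ^ (c j * (v j ⬝ᵥ v j))) *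
          Real.exp (-Real.pi * ∑ j, c j * (v j ⬝ᵥ v j) * T (x ⬝ᵥ v j) ^ 2)) := by
          rw [Finset.mul_sum, Real.exp_sum, hC, ← Finset.prod_mul_distrib,
            ← Finset.prod_mul_distrib]
          refine (Finset.prod_eq_one fun j _ ↦ ?_).symm
          have h1 : Real.exp (-Real.pi * (c j * (v j ⬝ᵥ v j) * T (x ⬝ᵥ v j) ^ 2)) =
              Real.exp (-Real.pi * T (x ⬝ᵥ v j) ^ 2) ^ (c j * (v j ⬝ᵥ v j)) := by
            rw [← Real.exp_mul]
            ring_nf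
          rw [h1, ← Real.mul_rpow (ht x j).le (Real.exp_nonneg _),
            ← Real.mul_rpow (by positivity) (mul_nonneg (ht x j).le (Real.exp_nonneg _))]
          have h2 : 2 / √(v j ⬝ᵥ v j) * (t x j * Real.exp (-Real.pi * T (x ⬝ᵥ v j) ^ 2)) = 1 := by
            have := (hr j).ne'
            simp only [t, neg_mul, Real.exp_neg]
            field_simp
          rw [h2, Real.one_rpow]
      _ ≤ _ := by
          refine mul_le_mul_of_nonneg_left (mul_le_mul ((hdet x).trans (le_abs_self _))
            (Real.exp_le_exp.2 ?_) (Real.exp_nonneg _) (abs_nonneg _)) hC0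
          exact mul_le_mul_of_nonpos_left hnorm (neg_nonpos.2 Real.pi_pos.le)
  have hKm : MeasurableSet K := measurableSet_setOf_abs_dotProduct_lt_one v
  calc volume K = ∫⁻ _ in K, 1 := by simp
    _ ≤ ∫⁻ x in K, ENNReal.ofReal C *
          (ENNReal.ofReal |(LinearMap.toContinuousLinearMap (M x).toLin').det| *
            ENNReal.ofReal (Real.exp (-Real.pi * (Θ x ⬝ᵥ Θ x)))) := by
        refine lintegral_mono fun x ↦ ?_
        rw [← ENNReal.ofReal_mul (abs_nonneg _), ← ENNReal.ofReal_mul hC0,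
          LinearMap.det_toContinuousLinearMap, LinearMap.det_toLin']
        exact ENNReal.one_le_ofReal.2 (hone x)
    _ = ENNReal.ofReal C * ∫⁻ y in Θ '' K,
          ENNReal.ofReal (Real.exp (-Real.pi * (y ⬝ᵥ y))) := by
        rw [lintegral_const_mul' _ _ ENNReal.ofReal_ne_top,
          lintegral_image_eq_lintegral_abs_det_fderiv_mul volume hKm hΘ hinj]
    _ ≤ ENNReal.ofReal C * 1 := by
        rw [← lintegral_exp_neg_pi_dotProduct_self (n := n)]
        gcongr
        exact Measure.restrict_le_self
    _ = _ := mul_one _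

open Filter Topology Pointwise in
/-- Ball's volume bound for an intersection of closed strips. -/
theorem volume_strips_le {c : ι → ℝ} {v : ι → n → ℝ} (hc : ∀ j, 0 < c j)
    (hv : ∀ j, 0 < v j ⬝ᵥ v j) (h : ∑ j, c j • Matrix.vecMulVec (v j) (v j) = 1) :
    volume {x : n → ℝ | ∀ j, |x ⬝ᵥ v j| ≤ 1} ≤
      ENNReal.ofReal (∏ j, (2 / √(v j ⬝ᵥ v j)) ^ (c j * (v j ⬝ᵥ v j))) := by
  set K := {x : n → ℝ | ∀ j, |x ⬝ᵥ v j| ≤ 1}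
  have hlim : Tendsto (fun r : ℝ ↦ ENNReal.ofReal |r ^ Module.finrank ℝ (n → ℝ)| * volume K)
      (𝓝[<] 1) (𝓝 (1 * volume K)) := by
    refine ENNReal.Tendsto.mul_const ?_ (Or.inl one_ne_zero)
    have : Continuous fun r : ℝ ↦ ENNReal.ofReal |r ^ Module.finrank ℝ (n → ℝ)| :=
      ENNReal.continuous_ofReal.comp (by fun_prop)
    simpa using (this.tendsto 1).mono_left nhdsWithin_le_nhds
  rw [one_mul] at hlim
  refine le_of_tendsto hlim ?_
  filter_upwards [Ioo_mem_nhdsLT (zero_lt_one' ℝ)] with r hr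
  rw [← Measure.addHaar_smul]
  refine (measure_mono ?_).trans (volume_open_strips_le hc hv h)
  rintro _ ⟨x, hx, rfl⟩ j
  simp only [smul_dotProduct, smul_eq_mul, abs_mul, abs_of_pos hr.1]
  nlinarith [hx j, hr.1, hr.2, abs_nonneg (x ⬝ᵥ v j)]

end Strips

open scoped MatrixOrder in
theorem exists_transpose_mul_self_of_dotProduct_le {n : Type*} [Fintype n] [DecidableEq n]
    {A : Matrix n n ℝ} (hA : A.IsHermitian) (h : ∀ x, x ⬝ᵥ x ≤ x ⬝ᵥ A *ᵥ x) :
    ∃ B : Matrix n n ℝ, A = Bᵀ * B := by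
  have hpos : A.PosSemidef := .of_dotProduct_mulVec_nonneg hA fun x ↦ by
    rw [star_trivial]
    exact (Finset.sum_nonneg fun i _ ↦ mul_self_nonneg _).trans (h x)
  obtain ⟨B, hB⟩ := CStarAlgebra.nonneg_iff_eq_star_mul_self.mp hpos.nonneg
  exact ⟨B, by rw [hB, Matrix.star_eq_conjTranspose, Matrix.conjTranspose_eq_transpose_of_trivial]⟩

/-- If unit vectors `wⱼ` and weights `cⱼ > 0` satisfy `I_n ⪯ Σ cⱼ wⱼ ⊗ wⱼ ⪯ γ I_n`, then
the intersection of strips `⋂ⱼ {x : |⟨x, wⱼ⟩| ≤ 1}` has volume at most `2ⁿ γ^{n/2}`. -/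
theorem volume_strips_approx_john (n s : ℕ) (γ : ℝ) (hγ : 1 < γ)
    (w : Fin s → Fin n → ℝ) (hw : ∀ j, w j ⬝ᵥ w j = 1)
    (c : Fin s → ℝ) (hc : ∀ j, 0 < c j)
    (h1 : ∀ x : Fin n → ℝ,
      x ⬝ᵥ x ≤ x ⬝ᵥ (∑ j, c j • Matrix.vecMulVec (w j) (w j)).mulVec x)
    (h2 : ∀ x : Fin n → ℝ,
      x ⬝ᵥ (∑ j, c j • Matrix.vecMulVec (w j) (w j)).mulVec x ≤ γ * (x ⬝ᵥ x)) :
    volume (⋂ j, {x : Fin n → ℝ | |x ⬝ᵥ w j| ≤ 1}) ≤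
      ENNReal.ofReal (2 ^ n * γ ^ ((n : ℝ) / 2)) := by
  have hγ0 : 0 < γ := zero_lt_one.trans hγ
  have hA := isHermitian_sum_smul_vecMulVec c w
  set A := ∑ j, c j • Matrix.vecMulVec (w j) (w j) with hAdef
  have hdetA : 1 ≤ A.det := one_le_det_of_dotProduct_le hA h1
  obtain ⟨B, hB⟩ := exists_transpose_mul_self_of_dotProduct_le hA h1
  have hdetB : 1 ≤ |B.det| := by
    rw [hB, Matrix.det_mul, Matrix.det_transpose, ← abs_mul_abs_self] at hdetA
    nlinarith [abs_nonneg B.det]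
  have hunit : IsUnit B.det := isUnit_iff_ne_zero.2 fun h0 ↦ by norm_num [h0] at hdetB
  have hunit' : IsUnit Bᵀ.det := by rwa [Matrix.det_transpose]
  let v : Fin s → Fin n → ℝ := fun j ↦ (Bᵀ)⁻¹ *ᵥ w j
  have hvw : ∀ j, Bᵀ *ᵥ v j = w j := fun j ↦ by
    simp [v, Matrix.mulVec_mulVec, Matrix.mul_nonsing_inv _ hunit']
  have hid : ∑ j, c j • Matrix.vecMulVec (v j) (v j) = 1 := by
    have h3 : ∀ j, Matrix.vecMulVec (v j) (v j) =
        (Bᵀ)⁻¹ * Matrix.vecMulVec (w j) (w j) * B⁻¹ := fun j ↦ by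
      rw [Matrix.mul_vecMulVec, Matrix.vecMulVec_mul, ← Matrix.mulVec_transpose,
        Matrix.transpose_nonsing_inv]
    have h4 : ∑ j, c j • Matrix.vecMulVec (v j) (v j) = (Bᵀ)⁻¹ * A * B⁻¹ := by
      simp only [hAdef, h3, Matrix.mul_sum, Matrix.sum_mul, Matrix.mul_smul, Matrix.smul_mul]
    rw [h4, hB, ← mul_assoc, Matrix.nonsing_inv_mul _ hunit', one_mul,
      Matrix.mul_nonsing_inv _ hunit]
  have hv : ∀ j, 1 ≤ γ * (v j ⬝ᵥ v j) := by
    intro j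
    have h3 : v j ⬝ᵥ B *ᵥ w j = 1 := by
      rw [Matrix.dotProduct_mulVec, ← Matrix.mulVec_transpose, hvw, hw]
    have h4 : (B *ᵥ w j) ⬝ᵥ (B *ᵥ w j) ≤ γ := by
      have := h2 (w j)
      rw [hw, mul_one, hB, ← Matrix.mulVec_mulVec, Matrix.dotProduct_mulVec,
        Matrix.vecMul_transpose] at this
      exact this
    have h5 : (v j ⬝ᵥ B *ᵥ w j) ^ 2 ≤ (v j ⬝ᵥ v j) * ((B *ᵥ w j) ⬝ᵥ (B *ᵥ w j)) := by
      simpa only [dotProduct, sq] using Finset.sum_mul_sq_le_sq_mul_sq Finset.univ (v j) (B *ᵥ w j)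
    have h6 : 0 ≤ v j ⬝ᵥ v j := Finset.sum_nonneg fun i _ ↦ mul_self_nonneg _
    rw [h3, one_pow] at h5
    nlinarith
  have hv0 : ∀ j, 0 < v j ⬝ᵥ v j := fun j ↦
    pos_of_mul_pos_right (zero_lt_one.trans_le (hv j)) hγ0.le
  have hset : (⋂ j, {x : Fin n → ℝ | |x ⬝ᵥ w j| ≤ 1}) =
      B.toLin' ⁻¹' {x : Fin n → ℝ | ∀ j, |x ⬝ᵥ v j| ≤ 1} := by
    ext x
    simp only [Set.mem_iInter, Set.mem_ofPred_eq, Set.mem_preimage, Matrix.toLin'_apply]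
    refine forall_congr' fun j ↦ ?_
    rw [← hvw j, Matrix.dotProduct_mulVec, Matrix.vecMul_transpose]
  have hdet : LinearMap.det B.toLin' ≠ 0 := by rw [LinearMap.det_toLin']; exact hunit.ne_zero
  rw [hset, Measure.addHaar_preimage_linearMap _ hdet, LinearMap.det_toLin']
  calc ENNReal.ofReal |B.det⁻¹| * volume {x : Fin n → ℝ | ∀ j, |x ⬝ᵥ v j| ≤ 1}
      ≤ 1 * volume {x : Fin n → ℝ | ∀ j, |x ⬝ᵥ v j| ≤ 1} := by
        gcongr
        rw [ENNReal.ofReal_le_one, abs_inv]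
        exact inv_le_one_of_one_le₀ hdetB
    _ ≤ ENNReal.ofReal (∏ j, (2 / √(v j ⬝ᵥ v j)) ^ (c j * (v j ⬝ᵥ v j))) := by
        rw [one_mul]
        exact volume_strips_le hc hv0 hid
    _ ≤ ENNReal.ofReal (∏ j, (2 * √γ) ^ (c j * (v j ⬝ᵥ v j))) := by
        refine ENNReal.ofReal_le_ofReal (Finset.prod_le_prod
          (fun j _ ↦ Real.rpow_nonneg (by positivity) _) fun j _ ↦ ?_)
        refine Real.rpow_le_rpow (by positivity) ?_ (mul_pos (hc j) (hv0 j)).le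
        rw [div_le_iff₀ (Real.sqrt_pos.2 (hv0 j)), mul_assoc, ← Real.sqrt_mul hγ0.le]
        linarith [Real.one_le_sqrt.2 (hv j)]
    _ = ENNReal.ofReal (2 ^ n * γ ^ ((n : ℝ) / 2)) := by
        rw [← Real.rpow_sum_of_pos (by positivity), sum_mul_dotProduct_self hid, Fintype.card_fin,
          Real.mul_rpow two_pos.le (Real.sqrt_nonneg _), Real.rpow_natCast, Real.sqrt_eq_rpow,
          ← Real.rpow_mul hγ0.le]
        ring_nf
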